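/- Let d ≥ 1, ρ > 0, ℓ > 0, ε > 0, and let f : ℝ^d → ℝ be ℓ-smooth, twice continuously differentiable and ρ-Hessian Lipschitz. If the step size is η = 1/(4ℓ) and the smoothing parameter satisfies 0 < μ ≤ √(3ε/(4ρ√d)), then for every x ∈ ℝ^d the zeroth-order gradient descent step x' = x − η·∇̂_coord f(x) satisfies f(x) − f(x') ≥ (1/(16ℓ))·(‖∇f(x)‖² − ε²/8). -/

import Mathlib

/-- The central-difference coordinate-wise gradient estimator
`∇̂_coord f(x) = Σ_i ((f(x+μeᵢ) − f(x−μeᵢ))/(2μ)) eᵢ`. -/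
noncomputable def coordGrad (d : ℕ) (f : EuclideanSpace ℝ (Fin d) → ℝ) (μ : ℝ)
    (x : EuclideanSpace ℝ (Fin d)) : EuclideanSpace ℝ (Fin d) :=
  ∑ i : Fin d,
    ((f (x + μ • EuclideanSpace.single i 1) - f (x - μ • EuclideanSpace.single i 1)) / (2 * μ))
      • EuclideanSpace.single i 1

/-- A curve starting at `0` whose velocity is bounded in norm by `B'` stays below `B`. -/
theorem norm_le_of_norm_hasDerivAt_le {E : Type*} [NormedAddCommGroup E] [NormedSpace ℝ E]
    {φ φ' : ℝ → E} {B B' : ℝ → ℝ} (h0 : φ 0 = 0) (hB0 : B 0 = 0)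
    (hφ : ∀ t, HasDerivAt φ (φ' t) t) (hB : ∀ t, HasDerivAt B (B' t) t)
    (bound : ∀ t, 0 ≤ t → ‖φ' t‖ ≤ B' t) {t : ℝ} (ht : 0 ≤ t) : ‖φ t‖ ≤ B t :=
  image_norm_le_of_norm_deriv_right_le_deriv_boundary (a := 0) (b := t)
    (fun s _ => (hφ s).continuousAt.continuousWithinAt)
    (fun s _ => (hφ s).hasDerivWithinAt) (by simp [h0, hB0]) hB
    (fun s hs => bound s hs.1) ⟨ht, le_rfl⟩

section Hilbert

variable {F : Type*} [NormedAddCommGroup F] [InnerProductSpace ℝ F]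

theorem hasDerivAt_add_smul (x v : F) (t : ℝ) : HasDerivAt (fun s : ℝ => x + s • v) v t := by
  simpa using ((hasDerivAt_id t).smul_const v).const_add x

variable [CompleteSpace F]

theorem hasDerivAt_comp_add_smul {f : F → ℝ} (hf : Differentiable ℝ f) (x v : F) (t : ℝ) :
    HasDerivAt (fun s : ℝ => f (x + s • v)) (inner ℝ (gradient f (x + t • v)) v) t := by
  simpa [Function.comp_def] using
    (hf (x + t • v)).hasGradientAt.hasFDerivAt.comp_hasDerivAt t (hasDerivAt_add_smul x v t)

theorem differentiable_gradient {f : F → ℝ} (hf : ContDiff ℝ 2 f) :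
    Differentiable ℝ (gradient f) := by
  have h : ContDiff ℝ 1 (fderiv ℝ f) := hf.fderiv_right (by norm_num)
  exact (InnerProductSpace.toDual ℝ F).symm.toContinuousLinearEquiv.differentiable.comp
    (h.differentiable (by norm_num))

/-- The descent lemma: a function with `L`-Lipschitz gradient lies within `L / 2 * ‖v‖ ^ 2` of its
linearization. -/
theorem abs_sub_linearization_le {f : F → ℝ} {L : ℝ} (hf : Differentiable ℝ f)
    (hL : ∀ x y, ‖gradient f x - gradient f y‖ ≤ L * ‖x - y‖) (x v : F) :
    |f (x + v) - f x - inner ℝ (gradient f x) v| ≤ L / 2 * ‖v‖ ^ 2 := by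
  have h := norm_le_of_norm_hasDerivAt_le
    (φ := fun t : ℝ => f (x + t • v) - f x - t * inner ℝ (gradient f x) v)
    (φ' := fun t => inner ℝ (gradient f (x + t • v)) v - inner ℝ (gradient f x) v)
    (B := fun t => L / 2 * ‖v‖ ^ 2 * t ^ 2) (B' := fun t => L * t * ‖v‖ ^ 2)
    (by simp) (by simp)
    (fun t => by
      simpa [Pi.sub_def] using ((hasDerivAt_comp_add_smul hf x v t).sub_const (f x)).sub
        ((hasDerivAt_id t).mul_const (inner ℝ (gradient f x) v)))
    (fun t => ((hasDerivAt_pow 2 t).const_mul (L / 2 * ‖v‖ ^ 2)).congr_deriv (by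
      norm_num
      ring))
    (fun t ht => by
      rw [← inner_sub_left]
      calc _ ≤ ‖gradient f (x + t • v) - gradient f x‖ * ‖v‖ := norm_inner_le_norm _ _
        _ ≤ (L * ‖x + t • v - x‖) * ‖v‖ := by gcongr; exact hL _ _
        _ = L * t * ‖v‖ ^ 2 := by
          rw [add_sub_cancel_left, norm_smul, Real.norm_of_nonneg ht]
          ring)
    (zero_le_one' ℝ)
  simpa using h

/-- The symmetric second difference of the gradient of a function with `M`-Lipschitz Hessian. -/
theorem norm_gradient_add_gradient_sub_le {f : F → ℝ} {M : ℝ} (hf : ContDiff ℝ 2 f)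
    (hM : ∀ x y, ‖fderiv ℝ (gradient f) x - fderiv ℝ (gradient f) y‖ ≤ M * ‖x - y‖)
    (x v : F) {t : ℝ} (ht : 0 ≤ t) :
    ‖gradient f (x + t • v) + gradient f (x + t • -v) - (2 : ℝ) • gradient f x‖
      ≤ M * ‖v‖ ^ 2 * t ^ 2 := by
  have hd (w : F) (t : ℝ) : HasDerivAt (fun s : ℝ => gradient f (x + s • w))
      (fderiv ℝ (gradient f) (x + t • w) w) t :=
    (differentiable_gradient hf _).hasFDerivAt.comp_hasDerivAt t (hasDerivAt_add_smul x w t)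
  refine norm_le_of_norm_hasDerivAt_le
    (φ := fun t : ℝ => gradient f (x + t • v) + gradient f (x + t • -v) - (2 : ℝ) • gradient f x)
    (B := fun t => M * ‖v‖ ^ 2 * t ^ 2) (B' := fun t => M * (2 * t * ‖v‖) * ‖v‖)
    (by simp [two_smul]) (by simp)
    (fun t => ((hd v t).add (hd (-v) t)).sub_const _)
    (fun t => ((hasDerivAt_pow 2 t).const_mul (M * ‖v‖ ^ 2)).congr_deriv (by
      norm_num
      ring))
    (fun t ht => ?_) ht
  rw [map_neg, ← sub_eq_add_neg, ← sub_apply]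
  refine (ContinuousLinearMap.le_opNorm _ _).trans ?_
  gcongr
  refine (hM _ _).trans_eq ?_
  rw [show x + t • v - (x + t • -v) = (2 * t) • v by module, norm_smul,
    Real.norm_of_nonneg (by positivity)]

/-- Error of the symmetric difference of a function with `M`-Lipschitz Hessian. -/
theorem abs_symmetric_difference_sub_le {f : F → ℝ} {M : ℝ} (hf : ContDiff ℝ 2 f)
    (hM : ∀ x y, ‖fderiv ℝ (gradient f) x - fderiv ℝ (gradient f) y‖ ≤ M * ‖x - y‖)
    (x v : F) {t : ℝ} (ht : 0 ≤ t) :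
    |f (x + t • v) - f (x - t • v) - 2 * t * inner ℝ (gradient f x) v|
      ≤ M / 3 * ‖v‖ ^ 3 * t ^ 3 := by
  have hd := hf.differentiable (by norm_num)
  have h := norm_le_of_norm_hasDerivAt_le
    (φ := fun t : ℝ => f (x + t • v) - f (x + t • -v) - t * (2 * inner ℝ (gradient f x) v))
    (B := fun t => M / 3 * ‖v‖ ^ 3 * t ^ 3) (B' := fun t => M * ‖v‖ ^ 2 * t ^ 2 * ‖v‖)
    (by simp) (by simp)
    (fun t => ((hasDerivAt_comp_add_smul hd x v t).sub (hasDerivAt_comp_add_smul hd x (-v) t)).sub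
        ((hasDerivAt_id t).mul_const (2 * inner ℝ (gradient f x) v)))
    (fun t => ((hasDerivAt_pow 3 t).const_mul (M / 3 * ‖v‖ ^ 3)).congr_deriv (by
      norm_num
      ring))
    (fun t ht => by
      have e : inner ℝ (gradient f (x + t • v)) v - inner ℝ (gradient f (x + t • -v)) (-v)
          - 1 * (2 * inner ℝ (gradient f x) v) =
          inner ℝ (gradient f (x + t • v) + gradient f (x + t • -v) - (2 : ℝ) • gradient f x) v := by
        rw [inner_sub_left, inner_add_left, real_inner_smul_left, inner_neg_right]
        ring
      rw [e]
      refine (norm_inner_le_norm _ _).trans ?_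
      gcongr
      exact norm_gradient_add_gradient_sub_le hf hM x v ht)
    ht
  rw [Real.norm_eq_abs] at h
  convert h using 2
  rw [smul_neg, ← sub_eq_add_neg]
  ring

end Hilbert

theorem coordGrad_apply {d : ℕ} (f : EuclideanSpace ℝ (Fin d) → ℝ) (μ : ℝ)
    (x : EuclideanSpace ℝ (Fin d)) (i : Fin d) :
    coordGrad d f μ x i =
      (f (x + μ • EuclideanSpace.single i 1) - f (x - μ • EuclideanSpace.single i 1)) / (2 * μ) := by
  simp [coordGrad, Pi.single_apply]

/-- Accuracy of the central-difference estimator for a function with `M`-Lipschitz Hessian. -/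
theorem norm_coordGrad_sub_gradient_le {d : ℕ} {f : EuclideanSpace ℝ (Fin d) → ℝ} {M μ : ℝ}
    (hf : ContDiff ℝ 2 f) (hM0 : 0 ≤ M)
    (hM : ∀ x y, ‖fderiv ℝ (gradient f) x - fderiv ℝ (gradient f) y‖ ≤ M * ‖x - y‖)
    (hμ : 0 < μ) (x : EuclideanSpace ℝ (Fin d)) :
    ‖coordGrad d f μ x - gradient f x‖ ≤ √d * (M * μ ^ 2 / 6) := by
  have hi (i : Fin d) : ‖(coordGrad d f μ x - gradient f x) i‖ ≤ M * μ ^ 2 / 6 := by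
    have h := abs_symmetric_difference_sub_le hf hM x (EuclideanSpace.single i 1) hμ.le
    have hin : inner ℝ (gradient f x) (EuclideanSpace.single i (1 : ℝ)) = gradient f x i := by
      rw [EuclideanSpace.inner_single_right]
      simp
    rw [hin, PiLp.norm_single, norm_one, one_pow, mul_one] at h
    rw [PiLp.sub_apply, coordGrad_apply, Real.norm_eq_abs, div_sub' (by positivity), abs_div,
      abs_of_pos (by positivity : 0 < 2 * μ), div_le_iff₀ (by positivity)]
    exact h.trans_eq (by ring)
  rw [← Real.sqrt_sq (by positivity : 0 ≤ M * μ ^ 2 / 6), ← Real.sqrt_mul (by positivity),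
    EuclideanSpace.norm_eq]
  refine Real.sqrt_le_sqrt ?_
  calc ∑ i, ‖(coordGrad d f μ x - gradient f x) i‖ ^ 2 ≤ ∑ _i : Fin d, (M * μ ^ 2 / 6) ^ 2 := by
        gcongr with i
        exact hi i
    _ = d * (M * μ ^ 2 / 6) ^ 2 := by simp


/-- Descent of the zeroth-order gradient descent step with step size `η = 1/(4ℓ)`:
if `f : ℝ^d → ℝ` (`d ≥ 1`) is `ℓ`-smooth (`ℓ > 0`), twice continuously differentiable and
`ρ`-Hessian Lipschitz (`ρ > 0`), `ε > 0`, and `0 < μ ≤ √(3ε/(4ρ√d))`, then for every `x` the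
step `x' = x − (1/(4ℓ))∇̂_coord f(x)` satisfies
`f(x) − f(x') ≥ (1/(16ℓ))(‖∇f(x)‖² − ε²/8)`. -/
theorem zo_gd_descent_tuned (d : ℕ) (hd : 1 ≤ d) (f : EuclideanSpace ℝ (Fin d) → ℝ)
    (ℓ ρ ε : ℝ) (hℓ : 0 < ℓ) (hρ : 0 < ρ) (hε : 0 < ε)
    (hf : ContDiff ℝ 2 f)
    (hGradLip : ∀ x y : EuclideanSpace ℝ (Fin d), ‖gradient f x - gradient f y‖ ≤ ℓ * ‖x - y‖)
    (hHessLip : ∀ x y : EuclideanSpace ℝ (Fin d),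
      ‖fderiv ℝ (gradient f) x - fderiv ℝ (gradient f) y‖ ≤ ρ * ‖x - y‖)
    (μ : ℝ) (hμ0 : 0 < μ) (hμ : μ ≤ Real.sqrt (3 * ε / (4 * ρ * Real.sqrt d)))
    (x : EuclideanSpace ℝ (Fin d)) :
    f x - f (x - (1 / (4 * ℓ)) • coordGrad d f μ x)
      ≥ 1 / (16 * ℓ) * (‖gradient f x‖ ^ 2 - ε ^ 2 / 8) := by
  have hd0 : 0 < √(d : ℝ) := Real.sqrt_pos.2 (by exact_mod_cast hd)
  have hμ2 : μ ^ 2 ≤ 3 * ε / (4 * ρ * √(d : ℝ)) :=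
    (Real.le_sqrt hμ0.le (by positivity)).1 hμ
  obtain ⟨e, he⟩ : ∃ e, coordGrad d f μ x = gradient f x + e := ⟨_, (add_sub_cancel _ _).symm⟩
  have herr : ‖e‖ ≤ ε / 8 := by
    have h := norm_coordGrad_sub_gradient_le hf hρ.le hHessLip hμ0 x
    rw [he, add_sub_cancel_left] at h
    refine h.trans ?_
    rw [le_div_iff₀ (by positivity)] at hμ2
    linarith
  have hdesc := (abs_le.1 (abs_sub_linearization_le (hf.differentiable (by norm_num)) hGradLip x
    (-((1 / (4 * ℓ)) • coordGrad d f μ x)))).2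
  rw [← sub_eq_add_neg, norm_neg, inner_neg_right, real_inner_smul_right, norm_smul, mul_pow,
    Real.norm_of_nonneg (by positivity), he, inner_add_right, real_inner_self_eq_norm_sq,
    norm_add_sq_real] at hdesc
  have hsq : 0 ≤ ‖gradient f x‖ ^ 2 + 2 * inner ℝ (gradient f x) e + ‖e‖ ^ 2 := by
    rw [← norm_add_sq_real]
    positivity
  have hee : ‖e‖ ^ 2 ≤ (ε / 8) ^ 2 := by gcongr
  have key : 1 / (16 * ℓ) * (‖gradient f x‖ ^ 2 - ε ^ 2 / 8) ≤
      1 / (4 * ℓ) * (‖gradient f x‖ ^ 2 + inner ℝ (gradient f x) e) - ℓ / 2 * ((1 / (4 * ℓ)) ^ 2 *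
        (‖gradient f x‖ ^ 2 + 2 * inner ℝ (gradient f x) e + ‖e‖ ^ 2)) := by
    have h : 0 ≤ 1 / (32 * ℓ) * (5 * ‖gradient f x‖ ^ 2 + 6 * inner ℝ (gradient f x) e - ‖e‖ ^ 2
        + ε ^ 2 / 4) :=
      mul_nonneg (by positivity) (by nlinarith [sq_nonneg ‖gradient f x‖, sq_nonneg ε])
    rw [← sub_nonneg]
    refine h.trans_eq ?_
    field_simp
    ring
  rw [he]
  linarith
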